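/- arXiv:2605.14983 — 13 statements merged into one kernel-verified Lean document; each statement's English description precedes it below -/
import Mathlib

section
/- Let E=(C,V) be an approval election with n voters and m candidates such that min(avl(E), rev-avl(E)) > 0. Then cntr-agr(E) = 1 if and only if E is an identity election, and cntr-agr(E) = 0 if and only if cen(E) contains the vote approving all candidates or cen(E) contains the vote disapproving all candidates. -/
open Finset

/-- The number of voters approving candidate `c` in the election `V`. -/
def score {m n : ℕ} (V : Fin n → Fin m → Bool) (c : Fin m) : ℕ :=
  (Finset.univ.filter (fun i => V i c = true)).card

/-- The number of candidates approved in the vote `v`. -/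
def voteLen {m : ℕ} (v : Fin m → Bool) : ℕ :=
  (Finset.univ.filter (fun j => v j = true)).card

/-- The Hamming distance between two votes. -/
def hamm {m : ℕ} (u v : Fin m → Bool) : ℕ :=
  (Finset.univ.filter (fun j => u j ≠ v j)).card

/-- An election is an identity election if all voters cast the same vote. -/
def IsIdentity {m n : ℕ} (V : Fin n → Fin m → Bool) : Prop :=
  ∀ i i' : Fin n, V i = V i'

/-- The Approval Agreement index. -/
noncomputable def avAgr {m n : ℕ} (V : Fin n → Fin m → Bool) : ℝ :=
  (1 / (m : ℝ)) * ∑ c : Fin m, |1 - 2 * ((score V c : ℝ) / (n : ℝ))|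

/-- The average vote length. -/
noncomputable def avl {m n : ℕ} (V : Fin n → Fin m → Bool) : ℝ :=
  (∑ i : Fin n, (voteLen (V i) : ℝ)) / (n : ℝ)

/-- The reverse average vote length. -/
noncomputable def revAvl {m n : ℕ} (V : Fin n → Fin m → Bool) : ℝ :=
  (m : ℝ) - avl V

/-- The saturation of an election. -/
noncomputable def satr {m n : ℕ} (V : Fin n → Fin m → Bool) : ℝ :=
  avl V / (m : ℝ)

/-- A vote `u` is central for the election `V`: regarding each candidate, `u` agrees
with at least half of the voters. -/
def IsCentral {m n : ℕ} (V : Fin n → Fin m → Bool) (u : Fin m → Bool) : Prop :=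
  ∀ j : Fin m, (u j = true → n ≤ 2 * score V j) ∧ (u j = false → 2 * score V j ≤ n)

/-- The Central Agreement index, computed with the central vote `u`. -/
noncomputable def cntrAgrWith {m n : ℕ} (V : Fin n → Fin m → Bool) (u : Fin m → Bool) : ℝ :=
  1 - (∑ i : Fin n, (hamm (V i) u : ℝ)) / ((n : ℝ) * min (avl V) (revAvl V))

open scoped Classical in
/-- The Pearson correlation coefficient of two real vectors; by convention it is `1`
when one of the vectors is constant (zero denominator). -/
noncomputable def pcc {t : ℕ} (x y : Fin t → ℝ) : ℝ :=
  if Real.sqrt (∑ i, (x i - (∑ j, x j) / (t : ℝ)) ^ 2) = 0 ∨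
     Real.sqrt (∑ i, (y i - (∑ j, y j) / (t : ℝ)) ^ 2) = 0 then 1
  else (∑ i, (x i - (∑ j, x j) / (t : ℝ)) * (y i - (∑ j, y j) / (t : ℝ))) /
    (Real.sqrt (∑ i, (x i - (∑ j, x j) / (t : ℝ)) ^ 2) *
     Real.sqrt (∑ i, (y i - (∑ j, y j) / (t : ℝ)) ^ 2))

/-- A vote viewed as a real vector. -/
def toReal {m : ℕ} (v : Fin m → Bool) : Fin m → ℝ := fun j => if v j then 1 else 0

/-- The PCC Pairwise Agreement index. -/
noncomputable def pccAgr {m n : ℕ} (V : Fin n → Fin m → Bool) : ℝ :=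
  (1 / (n : ℝ) ^ 2) * ∑ i : Fin n, ∑ i' : Fin n, pcc (toReal (V i)) (toReal (V i'))

/-- The PCC⁺ Pairwise Agreement index. -/
noncomputable def pccPlusAgr {m n : ℕ} (V : Fin n → Fin m → Bool) : ℝ :=
  (1 / (n : ℝ) ^ 2) * ∑ i : Fin n, ∑ i' : Fin n, max 0 (pcc (toReal (V i)) (toReal (V i')))

/-- The Hamming Pairwise Agreement index. -/
noncomputable def pairAgr {m n : ℕ} (V : Fin n → Fin m → Bool) : ℝ :=
  1 - (∑ i : Fin n, ∑ i' : Fin n, (hamm (V i) (V i') : ℝ)) /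
    (2 * (n : ℝ) ^ 2 * (m : ℝ) * satr V * (1 - satr V))

/-- The Jaccard similarity `1 - jacc(u,v)` of two votes. -/
noncomputable def jaccSim {m : ℕ} (u v : Fin m → Bool) : ℝ :=
  ((Finset.univ.filter (fun j => u j = true ∧ v j = true)).card : ℝ) /
  ((Finset.univ.filter (fun j => u j = true ∨ v j = true)).card : ℝ)

/-- The Jaccard Pairwise Agreement index. -/
noncomputable def jaccAgr {m n : ℕ} (V : Fin n → Fin m → Bool) : ℝ :=
  (1 / (n : ℝ) ^ 2) * ∑ i : Fin n, ∑ i' : Fin n, jaccSim (V i) (V i')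

/-- The canonical central vote of an election. -/
def centralVote {m n : ℕ} (V : Fin n → Fin m → Bool) : Fin m → Bool :=
  fun j => decide (n < 2 * score V j)

/-- The central Hamming distance of an election. -/
def chd {m n : ℕ} (V : Fin n → Fin m → Bool) : ℕ :=
  ∑ i : Fin n, hamm (V i) (centralVote V)

/-- The total Hamming distance over all ordered pairs of votes. -/
def ehd {m n : ℕ} (V : Fin n → Fin m → Bool) : ℕ :=
  ∑ i : Fin n, ∑ i' : Fin n, hamm (V i) (V i')

/-- The matched normalized Hamming distance between two collections of votes. -/
noncomputable def mHam {m : ℕ} (k N : ℕ) (hk : 0 < k) (hN : 0 < N)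
    (U : Fin k → Fin m → Bool) (W : Fin N → Fin m → Bool) : ℝ :=
  ((Finset.univ.inf' ⟨Equiv.refl (Fin (k * N)), Finset.mem_univ _⟩
    (fun π : Equiv.Perm (Fin (k * N)) =>
      ∑ i : Fin (k * N),
        hamm (U ⟨i.val % k, Nat.mod_lt _ hk⟩)
             (W ⟨(π i).val % N, Nat.mod_lt _ hN⟩)) : ℕ) : ℝ) /
  ((k : ℝ) * (N : ℝ) * (m : ℝ))

theorem sum_voteLen_aux {m n : ℕ} (V : Fin n → Fin m → Bool) :
    ∑ i : Fin n, voteLen (V i) = ∑ j : Fin m, score V j := by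
  simp only [voteLen, score, Finset.card_filter]
  exact Finset.sum_comm

theorem score_add_aux {m n : ℕ} (V : Fin n → Fin m → Bool) (j : Fin m) :
    score V j + (Finset.univ.filter (fun i => V i j ≠ true)).card = n := by
  have h := Finset.card_filter_add_card_filter_not (s := (Finset.univ : Finset (Fin n)))
    (fun i => V i j = true)
  simpa [score] using h

theorem sum_hamm_aux {m n : ℕ} (V : Fin n → Fin m → Bool) (u : Fin m → Bool) :
    ∑ i : Fin n, hamm (V i) u = ∑ j : Fin m, if u j = true then n - score V j else score V j := by
  have h1 : ∑ i : Fin n, hamm (V i) u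
      = ∑ j : Fin m, (Finset.univ.filter (fun i => V i j ≠ u j)).card := by
    simp only [hamm, Finset.card_filter]
    exact Finset.sum_comm
  rw [h1]
  refine Finset.sum_congr rfl fun j _ => ?_
  have h := score_add_aux V j
  cases hj : u j
  · simp [score]
  · simp only [if_true]
    omega

theorem score_le_aux {m n : ℕ} (V : Fin n → Fin m → Bool) (j : Fin m) : score V j ≤ n := by
  have h := score_add_aux V j
  omega

theorem sum_hamm_central_aux {m n : ℕ} (V : Fin n → Fin m → Bool) (u : Fin m → Bool)
    (hu : IsCentral V u) :
    ∑ i : Fin n, hamm (V i) u = ∑ j : Fin m, min (score V j) (n - score V j) := by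
  rw [sum_hamm_aux]
  refine Finset.sum_congr rfl fun j _ => ?_
  have h := hu j
  have h2 := score_le_aux V j
  cases hj : u j
  · have := h.2 hj
    simp only [Bool.false_eq_true, if_false]
    omega
  · have := h.1 hj
    simp only [if_true]
    omega

/-- `cntr-agr(E) = 1` iff `E` is an identity election, and
`cntr-agr(E) = 0` iff the all-approving vote or the all-disapproving vote is central. -/
theorem cntrAgr_eq_one_iff_and_eq_zero_iff {m n : ℕ} (V : Fin n → Fin m → Bool)
    (hmin : 0 < min (avl V) (revAvl V))
    (u : Fin m → Bool) (hu : IsCentral V u) :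
    (cntrAgrWith V u = 1 ↔ IsIdentity V) ∧
    (cntrAgrWith V u = 0 ↔
      IsCentral V (fun _ => true) ∨ IsCentral V (fun _ => false)) := by
  have hn : 0 < n := by
    rcases Nat.eq_zero_or_pos n with h | h
    · subst h
      exact absurd (lt_of_lt_of_le hmin (min_le_left _ _)) (by simp [avl])
    · exact h
  have hnR : (0 : ℝ) < n := by exact_mod_cast hn
  have hD : 0 < (n : ℝ) * min (avl V) (revAvl V) := mul_pos hnR hmin
  have hle := score_le_aux V
  have hS : (n : ℝ) * avl V = ((∑ j : Fin m, score V j : ℕ) : ℝ) := by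
    rw [← sum_voteLen_aux, avl]
    push_cast
    field_simp
  have hR : (n : ℝ) * revAvl V = ((∑ j : Fin m, (n - score V j) : ℕ) : ℝ) := by
    rw [revAvl, mul_sub, hS]
    have h : ∑ j : Fin m, (n - score V j) + ∑ j : Fin m, score V j = n * m := by
      rw [← Finset.sum_add_distrib, Finset.sum_congr rfl (fun j _ => Nat.sub_add_cancel (hle j))]
      simp [mul_comm]
    have h' : ((∑ j : Fin m, (n - score V j) : ℕ) : ℝ) + ((∑ j : Fin m, score V j : ℕ) : ℝ)
        = n * m := by exact_mod_cast h
    linarith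
  have hM : (n : ℝ) * min (avl V) (revAvl V)
      = ((min (∑ j : Fin m, score V j) (∑ j : Fin m, (n - score V j)) : ℕ) : ℝ) := by
    rw [mul_min_of_nonneg _ _ hnR.le, hS, hR, Nat.cast_min]
  have hsum : ∑ i : Fin n, (hamm (V i) u : ℝ) = ((∑ i : Fin n, hamm (V i) u : ℕ) : ℝ) := by
    push_cast
    rfl
  constructor
  · have h1 : cntrAgrWith V u = 1 ↔ ∑ i : Fin n, hamm (V i) u = 0 := by
      rw [cntrAgrWith, sub_eq_self, div_eq_zero_iff, or_iff_left hD.ne', hsum, Nat.cast_eq_zero]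
    rw [h1]
    constructor
    · intro h
      have key : ∀ i, V i = u := by
        intro i
        have h2 := (Finset.sum_eq_zero_iff.mp h) i (Finset.mem_univ i)
        rw [hamm, Finset.card_eq_zero, Finset.filter_eq_empty_iff] at h2
        funext j
        simpa using h2 (Finset.mem_univ j)
      intro i i'
      rw [key i, key i']
    · intro h
      rw [sum_hamm_central_aux V u hu]
      refine Finset.sum_eq_zero fun j _ => ?_
      have h2 : score V j = 0 ∨ score V j = n := by
        cases hj : V ⟨0, hn⟩ j
        · left
          rw [score, Finset.card_eq_zero, Finset.filter_eq_empty_iff]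
          intro i _
          rw [h i ⟨0, hn⟩, hj]
          simp
        · right
          rw [score, Finset.filter_true_of_mem]
          · simp
          · intro i _
            rw [h i ⟨0, hn⟩, hj]
      omega
  · have h1 : cntrAgrWith V u = 0 ↔ ∑ i : Fin n, hamm (V i) u
        = min (∑ j : Fin m, score V j) (∑ j : Fin m, (n - score V j)) := by
      rw [cntrAgrWith, sub_eq_zero, eq_comm, div_eq_one_iff_eq hD.ne', hsum, hM, Nat.cast_inj]
    rw [h1, sum_hamm_central_aux V u hu]
    constructor
    · intro h
      rcases min_choice (∑ j : Fin m, score V j) (∑ j : Fin m, (n - score V j)) with h2 | h2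
      · right
        rw [h2] at h
        have h3 := (Finset.sum_eq_sum_iff_of_le (fun j _ => min_le_left _ _)).mp h
        intro j
        have h4 := h3 j (Finset.mem_univ j)
        have h5 := hle j
        refine ⟨fun h => by simp at h, fun _ => by omega⟩
      · left
        rw [h2] at h
        have h3 := (Finset.sum_eq_sum_iff_of_le (fun j _ => min_le_right _ _)).mp h
        intro j
        have h4 := h3 j (Finset.mem_univ j)
        have h5 := hle j
        refine ⟨fun _ => by omega, fun h => by simp at h⟩
    · rintro (h | h)
      · have h2 : ∀ j, n - score V j ≤ score V j := fun j => by
          have := (h j).1 rfl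
          omega
        rw [min_eq_right (Finset.sum_le_sum fun j _ => h2 j)]
        exact Finset.sum_congr rfl fun j _ => min_eq_right (h2 j)
      · have h2 : ∀ j, score V j ≤ n - score V j := fun j => by
          have := (h j).2 rfl
          omega
        rw [min_eq_left (Finset.sum_le_sum fun j _ => h2 j)]
        exact Finset.sum_congr rfl fun j _ => min_eq_left (h2 j)
end

section
/- Let E=(C,V) be an approval election with n voters and m candidates such that min(avl(E), rev-avl(E)) > 0. Then cntr-agr(E) = 1 − Σ_{c∈C} (1 − |1 − 2|A(c)|/n|) / (2·min(avl(E), rev-avl(E))). -/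
open Finset

/-- explicit formula for the Central Agreement index. -/
theorem cntrAgr_formula {m n : ℕ} (V : Fin n → Fin m → Bool)
    (hmin : 0 < min (avl V) (revAvl V))
    (u : Fin m → Bool) (hu : IsCentral V u) :
    cntrAgrWith V u =
      1 - (∑ c : Fin m, (1 - |1 - 2 * ((score V c : ℝ) / (n : ℝ))|)) /
        (2 * min (avl V) (revAvl V)) := by
  have hn : (0 : ℝ) < (n : ℝ) := by
    rcases Nat.eq_zero_or_pos n with h | h
    · subst h
      have h1 := (lt_min_iff.mp hmin).1
      simp [avl] at h1
    · exact_mod_cast h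
  have hcount : ∀ c : Fin m, 2 * (∑ i : Fin n, if V i c ≠ u c then (1 : ℝ) else 0) =
      n * (1 - |1 - 2 * ((score V c : ℝ) / (n : ℝ))|) := by
    intro c
    have hs : (score V c : ℝ) = ∑ i : Fin n, if V i c = true then (1 : ℝ) else 0 := by
      simp [score]
    have hfr : (n : ℝ) * ((score V c : ℝ) / (n : ℝ)) = score V c := by
      field_simp
    cases huc : u c with
    | true =>
      have h : (n : ℝ) ≤ 2 * (score V c : ℝ) := by exact_mod_cast (hu c).1 huc
      have h1 : 1 - 2 * ((score V c : ℝ) / (n : ℝ)) ≤ 0 := by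
        by_contra! hc
        nlinarith [mul_pos hn hc]
      have h2 : (∑ i : Fin n, if V i c ≠ true then (1 : ℝ) else 0) = n - score V c := by
        have h3 : (n : ℝ) = ∑ i : Fin n, (1 : ℝ) := by simp
        rw [hs, h3, ← Finset.sum_sub_distrib]
        refine Finset.sum_congr rfl fun i _ => ?_
        cases V i c <;> simp
      rw [abs_of_nonpos h1, h2]
      linarith
    | false =>
      have h : 2 * (score V c : ℝ) ≤ (n : ℝ) := by exact_mod_cast (hu c).2 huc
      have h1 : 0 ≤ 1 - 2 * ((score V c : ℝ) / (n : ℝ)) := by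
        by_contra! hc
        nlinarith [mul_neg_of_pos_of_neg hn hc]
      have h2 : (∑ i : Fin n, if V i c ≠ false then (1 : ℝ) else 0) = score V c := by
        rw [hs]
        refine Finset.sum_congr rfl fun i _ => ?_
        cases V i c <;> simp
      rw [abs_of_nonneg h1, h2]
      linarith
  have hsum : 2 * (∑ i : Fin n, (hamm (V i) u : ℝ)) =
      n * ∑ c : Fin m, (1 - |1 - 2 * ((score V c : ℝ) / (n : ℝ))|) := by
    have h1 : ∀ i, (hamm (V i) u : ℝ) = ∑ c : Fin m, if V i c ≠ u c then (1 : ℝ) else 0 := by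
      intro i
      rw [hamm, Finset.sum_boole]
    simp_rw [h1]
    rw [Finset.sum_comm, Finset.mul_sum, Finset.mul_sum]
    exact Finset.sum_congr rfl fun c _ => hcount c
  unfold cntrAgrWith
  congr 1
  rw [div_eq_div_iff (by positivity) (by positivity)]
  linear_combination (min (avl V) (revAvl V)) * hsum
end

section
/- For every approval election E=(C,V), the value pcc-agr(E) = (1/n²) Σ_{u∈V} Σ_{v∈V} pcc(u,v) satisfies 0 ≤ pcc-agr(E) ≤ 1. -/
open Finset

lemma pcc_le_one_aux {t : ℕ} (x y : Fin t → ℝ) : pcc x y ≤ 1 := by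
  unfold pcc
  split_ifs with h
  · exact le_refl _
  · exact div_le_one_of_le₀ (Real.sum_mul_le_sqrt_mul_sqrt _ _ _) (by positivity)

/-- The standard deviation (unnormalised). -/
noncomputable def sdAux {t : ℕ} (x : Fin t → ℝ) : ℝ :=
  Real.sqrt (∑ i, (x i - (∑ j, x j) / (t : ℝ)) ^ 2)

open scoped Classical in
/-- Indicator of being nonconstant. -/
noncomputable def ncAux {t : ℕ} (x : Fin t → ℝ) : ℝ := if sdAux x = 0 then 0 else 1

/-- Normalised centred vector. -/
noncomputable def eAux {t : ℕ} (x : Fin t → ℝ) (i : Fin t) : ℝ :=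
  (x i - (∑ j, x j) / (t : ℝ)) / sdAux x

lemma pcc_eq_aux {t : ℕ} (x y : Fin t → ℝ) :
    pcc x y = ∑ k, eAux x k * eAux y k + (1 - ncAux x * ncAux y) := by
  unfold pcc
  change (if sdAux x = 0 ∨ sdAux y = 0 then 1 else _ / (sdAux x * sdAux y)) = _
  split_ifs with h
  · rcases h with h | h <;> simp [eAux, ncAux, h]
  · push Not at h
    simp only [ncAux, h.1, h.2, if_false, eAux, Finset.sum_div]
    simp [div_mul_div_comm]

lemma sum_pcc_nonneg_aux {t n : ℕ} (X : Fin n → Fin t → ℝ) :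
    0 ≤ ∑ i, ∑ j, pcc (X i) (X j) := by
  have h1 : ∑ i, ∑ j, pcc (X i) (X j) =
      ∑ k, (∑ i, eAux (X i) k) ^ 2 + ((n : ℝ) ^ 2 - (∑ i, ncAux (X i)) ^ 2) := by
    simp only [pcc_eq_aux, Finset.sum_add_distrib, Finset.sum_sub_distrib, sq,
      Finset.sum_mul_sum]
    congr 1
    · conv_rhs => rw [Finset.sum_comm]
      refine Finset.sum_congr rfl fun i _ => ?_
      rw [Finset.sum_comm]
    · simp
  have h0 : 0 ≤ ∑ i, ncAux (X i) :=
    Finset.sum_nonneg fun i _ => by unfold ncAux; split_ifs <;> norm_num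
  have h2 : ∑ i, ncAux (X i) ≤ n := by
    calc ∑ i, ncAux (X i) ≤ ∑ _i : Fin n, (1 : ℝ) :=
          Finset.sum_le_sum fun i _ => by unfold ncAux; split_ifs <;> norm_num
      _ = n := by simp
  have h3 : 0 ≤ ∑ k, (∑ i, eAux (X i) k) ^ 2 := Finset.sum_nonneg fun _ _ => sq_nonneg _
  rw [h1]
  nlinarith

/-- for every approval election, `0 ≤ pcc-agr(E) ≤ 1`. -/
theorem pccAgr_mem_unit_interval {m n : ℕ} (V : Fin n → Fin m → Bool) :
    0 ≤ pccAgr V ∧ pccAgr V ≤ 1 := by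
  unfold pccAgr
  refine ⟨mul_nonneg (by positivity) (sum_pcc_nonneg_aux fun i => toReal (V i)), ?_⟩
  rw [one_div, inv_mul_eq_div]
  refine div_le_one_of_le₀ ?_ (by positivity)
  calc ∑ i : Fin n, ∑ i' : Fin n, pcc (toReal (V i)) (toReal (V i'))
      ≤ ∑ _i : Fin n, ∑ _i' : Fin n, (1 : ℝ) :=
        Finset.sum_le_sum fun i _ => Finset.sum_le_sum fun j _ => pcc_le_one_aux _ _
    _ = (n : ℝ) ^ 2 := by simp [sq]
end

section
/- Let E=(C,V) be an approval election with n voters and m candidates such that 0 < satr(E) < 1. Then pair-agr(E) = 1 − (Σ_{c∈C} |A(c)|·(n − |A(c)|)) / (n² m · satr(E)·(1 − satr(E))). -/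
open Finset

theorem hamm_sum_aux {m n : ℕ} (V : Fin n → Fin m → Bool) :
    (∑ i : Fin n, ∑ i' : Fin n, (hamm (V i) (V i') : ℝ)) =
      2 * ∑ c : Fin m, (score V c : ℝ) * ((n : ℝ) - (score V c : ℝ)) := by
  have hh : ∀ i i' : Fin n, (hamm (V i) (V i') : ℝ) =
      ∑ c : Fin m, ((if V i c = true then (1 : ℝ) else 0) + (if V i' c = true then (1 : ℝ) else 0)
        - 2 * ((if V i c = true then (1 : ℝ) else 0) * (if V i' c = true then (1 : ℝ) else 0))) := by
    intro i i'
    unfold hamm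
    rw [Finset.card_filter]
    push_cast
    refine Finset.sum_congr rfl fun c _ => ?_
    cases V i c <;> cases V i' c <;> norm_num
  have hsc : ∀ c : Fin m, (score V c : ℝ) = ∑ i : Fin n, (if V i c = true then (1 : ℝ) else 0) := by
    intro c
    unfold score
    rw [Finset.card_filter]
    push_cast
    rfl
  simp_rw [hh]
  rw [Finset.sum_congr rfl fun i _ => Finset.sum_comm, Finset.sum_comm, Finset.mul_sum]
  refine Finset.sum_congr rfl fun c _ => ?_
  simp only [Finset.sum_sub_distrib, Finset.sum_add_distrib, ← Finset.mul_sum, ← Finset.sum_mul,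
    ← hsc, Finset.sum_const, Finset.card_univ, Fintype.card_fin, nsmul_eq_mul]
  ring

/-- explicit formula for the Hamming Pairwise Agreement index. -/
theorem pairAgr_formula {m n : ℕ} (V : Fin n → Fin m → Bool)
    (hs0 : 0 < satr V) (hs1 : satr V < 1) :
    pairAgr V =
      1 - (∑ c : Fin m, (score V c : ℝ) * ((n : ℝ) - (score V c : ℝ))) /
        ((n : ℝ) ^ 2 * (m : ℝ) * satr V * (1 - satr V)) := by
  unfold pairAgr
  rw [hamm_sum_aux]
  congr 1
  rw [show 2 * (n : ℝ) ^ 2 * (m : ℝ) * satr V * (1 - satr V) =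
    2 * ((n : ℝ) ^ 2 * (m : ℝ) * satr V * (1 - satr V)) by ring]
  exact mul_div_mul_left _ _ two_ne_zero
end

section
/- Let E=(C,V) be an approval election with n voters and m candidates such that 0 < satr(E) < 1. Then pair-agr(E) = 1 if and only if E is an identity election. -/
open Finset

/-- `pair-agr(E) = 1` iff `E` is an identity election. -/
theorem pairAgr_eq_one_iff {m n : ℕ} (V : Fin n → Fin m → Bool)
    (hs0 : 0 < satr V) (hs1 : satr V < 1) :
    pairAgr V = 1 ↔ IsIdentity V := by
  have hm : (m : ℝ) ≠ 0 := by
    intro h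
    simp [satr, h] at hs0
  have hn : (n : ℝ) ≠ 0 := by
    intro h
    simp [satr, avl, h] at hs0
  have h1 : (1 - satr V) ≠ 0 := by linarith
  have hD : 2 * (n : ℝ) ^ 2 * (m : ℝ) * satr V * (1 - satr V) ≠ 0 := by
    have := hs0.ne'
    positivity
  have hz : ∀ u v : Fin m → Bool, hamm u v = 0 ↔ u = v := by
    intro u v
    simp [hamm, Finset.filter_eq_empty_iff, funext_iff]
  unfold pairAgr IsIdentity
  rw [sub_eq_self, div_eq_zero_iff, or_iff_left hD]
  rw [Finset.sum_eq_zero_iff_of_nonneg (fun i _ => Finset.sum_nonneg (fun j _ => Nat.cast_nonneg _))]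
  simp only [Finset.mem_univ, true_imp_iff]
  refine forall_congr' fun i => ?_
  rw [Finset.sum_eq_zero_iff_of_nonneg (fun j _ => Nat.cast_nonneg _)]
  simp only [Finset.mem_univ, true_imp_iff, Nat.cast_eq_zero, hz]
end

section
/- Let E=(C,V) be an approval election with n voters and m candidates such that 0 < satr(E) < 1. Then pair-agr(E) = 0 if and only if all candidates have equal approval score, i.e., |A(c)| = |A(c')| for all candidates c, c' ∈ C. -/
open Finset

/-- `pair-agr(E) = 0` iff all candidates have equal approval score. -/
theorem pairAgr_eq_zero_iff {m n : ℕ} (V : Fin n → Fin m → Bool)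
    (hs0 : 0 < satr V) (hs1 : satr V < 1) :
    pairAgr V = 0 ↔ ∀ c c' : Fin m, score V c = score V c' := by
  have hm : (m : ℝ) ≠ 0 := by
    intro h
    simp [satr, h] at hs0
  have hn : (n : ℝ) ≠ 0 := by
    intro h
    simp [satr, avl, h] at hs0
  have hmpos : (0 : ℝ) < m := lt_of_le_of_ne (Nat.cast_nonneg m) (Ne.symm hm)
  have hnpos : (0 : ℝ) < n := lt_of_le_of_ne (Nat.cast_nonneg n) (Ne.symm hn)
  have hscore : ∀ c, (score V c : ℝ) = ∑ i, toReal (V i) c := by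
    intro c
    simp [score, toReal]
  have hS : ∑ c, (score V c : ℝ) = n * m * satr V := by
    have h1 : ∑ c, (score V c : ℝ) = ∑ i, (voteLen (V i) : ℝ) := by
      simp only [hscore]
      rw [Finset.sum_comm]
      refine Finset.sum_congr rfl fun i _ => ?_
      simp [voteLen, toReal]
    rw [h1, satr, avl]
    field_simp
  have hham : ∀ i i', (hamm (V i) (V i') : ℝ) =
      ∑ c, (toReal (V i) c + toReal (V i') c - 2 * (toReal (V i) c * toReal (V i') c)) := by
    intro i i'
    rw [hamm, Finset.card_filter]
    push_cast
    refine Finset.sum_congr rfl fun c _ => ?_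
    cases h : V i c <;> cases h' : V i' c <;> norm_num [toReal, h, h']
  have hH : (∑ i : Fin n, ∑ i' : Fin n, (hamm (V i) (V i') : ℝ)) =
      ∑ c, (2 * n * (score V c : ℝ) - 2 * (score V c : ℝ) ^ 2) := by
    simp only [hham]
    have : ∀ i, ∑ i', ∑ c, (toReal (V i) c + toReal (V i') c
        - 2 * (toReal (V i) c * toReal (V i') c)) =
        ∑ c, (n * toReal (V i) c + score V c - 2 * (toReal (V i) c * score V c)) := by
      intro i
      rw [Finset.sum_comm]
      refine Finset.sum_congr rfl fun c _ => ?_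
      rw [Finset.sum_sub_distrib, Finset.sum_add_distrib, ← Finset.mul_sum, ← Finset.mul_sum,
        ← hscore]
      simp
    simp only [this]
    rw [Finset.sum_comm]
    refine Finset.sum_congr rfl fun c _ => ?_
    rw [Finset.sum_sub_distrib, Finset.sum_add_distrib, ← Finset.mul_sum, ← Finset.mul_sum,
        ← Finset.sum_mul, ← hscore]
    simp
    ring
  have hvar : ∑ c, ((score V c : ℝ) - n * satr V) ^ 2 =
      ∑ c, (score V c : ℝ) ^ 2 - n ^ 2 * m * satr V ^ 2 := by
    have : ∀ c, ((score V c : ℝ) - n * satr V) ^ 2 =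
      (score V c : ℝ) ^ 2 - (2 * n * satr V) * (score V c : ℝ) + (n * satr V) ^ 2 := by
      intro c; ring
    simp only [this]
    rw [Finset.sum_add_distrib, Finset.sum_sub_distrib, ← Finset.mul_sum, hS]
    simp
    ring
  have hD : 0 < 2 * (n : ℝ) ^ 2 * (m : ℝ) * satr V * (1 - satr V) := by
    have : 0 < 1 - satr V := by linarith
    positivity
  have key : pairAgr V = 0 ↔ ∑ c, ((score V c : ℝ) - n * satr V) ^ 2 = 0 := by
    rw [pairAgr, sub_eq_zero, eq_comm, div_eq_one_iff_eq hD.ne', hH, hvar,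
      Finset.sum_sub_distrib, ← Finset.mul_sum, ← Finset.mul_sum, hS]
    constructor <;> intro h <;> linarith
  rw [key, Finset.sum_eq_zero_iff_of_nonneg (fun _ _ => sq_nonneg _)]
  constructor
  · intro h c c'
    have h1 := pow_eq_zero_iff (two_ne_zero) |>.1 (h c (Finset.mem_univ _))
    have h2 := pow_eq_zero_iff (two_ne_zero) |>.1 (h c' (Finset.mem_univ _))
    have : (score V c : ℝ) = score V c' := by linarith
    exact_mod_cast this
  · intro h c _
    have h1 : ∑ c', (score V c' : ℝ) = m * score V c := by
      simp [fun c' => h c' c]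
    rw [hS] at h1
    have h2 : (score V c : ℝ) = n * satr V := by
      apply mul_left_cancel₀ hm
      linarith
    rw [h2]; simp
end

section
/- Let E=(C,V) be an approval election in which every vote is non-constant, i.e., every voter approves at least one candidate and disapproves at least one candidate. Then pcc-agr(E) = 1 if and only if E is an identity election, and pcc⁺-agr(E) = 1 if and only if E is an identity election. -/
open Finset

theorem pcc_aux {t : ℕ} (a b : Fin t → ℝ) (A B : ℝ) (hA : 0 < A) (hB : 0 < B)
    (hA2 : ∑ i, a i ^ 2 = A ^ 2) (hB2 : ∑ i, b i ^ 2 = B ^ 2) :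
    ∑ i, (a i / A - b i / B) ^ 2 = 2 - 2 * ((∑ i, a i * b i) / (A * B)) := by
  have h : ∀ i, (a i / A - b i / B) ^ 2
      = a i ^ 2 * (A ^ 2)⁻¹ + b i ^ 2 * (B ^ 2)⁻¹ - a i * b i * (2 / (A * B)) := by
    intro i
    field_simp
    ring
  simp_rw [h]
  rw [Finset.sum_sub_distrib, Finset.sum_add_distrib, ← Finset.sum_mul, ← Finset.sum_mul,
    ← Finset.sum_mul, hA2, hB2]
  field_simp
  ring

theorem sqrt_pos_of_nonconst {m : ℕ} (v : Fin m → Bool)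
    (h1 : ∃ j, v j = true) (h0 : ∃ j, v j = false) :
    0 < Real.sqrt (∑ i, (toReal v i - (∑ j, toReal v j) / (m : ℝ)) ^ 2) := by
  obtain ⟨j, hj⟩ := h1
  obtain ⟨k, hk⟩ := h0
  apply Real.sqrt_pos.2
  have hnn : 0 ≤ ∑ i, (toReal v i - (∑ j, toReal v j) / (m : ℝ)) ^ 2 :=
    Finset.sum_nonneg fun i _ => sq_nonneg _
  refine lt_of_le_of_ne hnn fun h => ?_
  have h2 := (Finset.sum_eq_zero_iff_of_nonneg (fun i _ => sq_nonneg _)).1 h.symm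
  have e1 := pow_eq_zero_iff (two_ne_zero) |>.1 (h2 j (Finset.mem_univ _))
  have e2 := pow_eq_zero_iff (two_ne_zero) |>.1 (h2 k (Finset.mem_univ _))
  have f1 : toReal v j = 1 := by simp [toReal, hj]
  have f2 : toReal v k = 0 := by simp [toReal, hk]
  linarith

theorem pcc_key {m : ℕ} (u v : Fin m → Bool)
    (hu1 : ∃ j, u j = true) (hu0 : ∃ j, u j = false)
    (hv1 : ∃ j, v j = true) (hv0 : ∃ j, v j = false) :
    pcc (toReal u) (toReal v) ≤ 1 ∧ (pcc (toReal u) (toReal v) = 1 ↔ u = v) := by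
  have hA := sqrt_pos_of_nonconst u hu1 hu0
  have hB := sqrt_pos_of_nonconst v hv1 hv0
  have hA2 := Real.sq_sqrt (Finset.sum_nonneg (s := Finset.univ)
    fun i _ => sq_nonneg (toReal u i - (∑ j, toReal u j) / (m : ℝ)))
  have hB2 := Real.sq_sqrt (Finset.sum_nonneg (s := Finset.univ)
    fun i _ => sq_nonneg (toReal v i - (∑ j, toReal v j) / (m : ℝ)))
  have key := pcc_aux (fun i => toReal u i - (∑ j, toReal u j) / (m : ℝ))
    (fun i => toReal v i - (∑ j, toReal v j) / (m : ℝ)) _ _ hA hB hA2.symm hB2.symm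
  have hp : pcc (toReal u) (toReal v) =
      (∑ i, (toReal u i - (∑ j, toReal u j) / (m : ℝ)) *
        (toReal v i - (∑ j, toReal v j) / (m : ℝ))) /
      (Real.sqrt (∑ i, (toReal u i - (∑ j, toReal u j) / (m : ℝ)) ^ 2) *
       Real.sqrt (∑ i, (toReal v i - (∑ j, toReal v j) / (m : ℝ)) ^ 2)) := by
    unfold pcc
    rw [if_neg (by push Not; exact ⟨hA.ne', hB.ne'⟩)]
  rw [← hp] at key
  have hnn : 0 ≤ 2 - 2 * pcc (toReal u) (toReal v) := by
    rw [← key]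
    exact Finset.sum_nonneg fun i _ => sq_nonneg _
  refine ⟨by linarith, fun h => ?_, fun h => ?_⟩
  · rw [h] at key
    norm_num at key
    have h2 := (Finset.sum_eq_zero_iff_of_nonneg (fun i _ => sq_nonneg _)).1 key
    generalize Real.sqrt (∑ i, (toReal u i - (∑ j, toReal u j) / (m : ℝ)) ^ 2) = A at *
    generalize Real.sqrt (∑ i, (toReal v i - (∑ j, toReal v j) / (m : ℝ)) ^ 2) = B at *
    generalize (∑ j, toReal u j) / (m : ℝ) = p at *
    generalize (∑ j, toReal v j) / (m : ℝ) = q at *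
    have h3 : ∀ i, (toReal u i - p) * B = (toReal v i - q) * A := by
      intro i
      have e := pow_eq_zero_iff (two_ne_zero) |>.1 (h2 i (Finset.mem_univ _))
      rw [sub_eq_zero, div_eq_div_iff hA.ne' hB.ne'] at e
      exact e
    obtain ⟨j, hj⟩ := hu1
    obtain ⟨k, hk⟩ := hu0
    have hj3 := h3 j
    have hk3 := h3 k
    funext i
    have hi3 := h3 i
    cases hvj : v j <;> cases hvk : v k <;> cases hui : u i <;> cases hvi : v i <;>
      simp [toReal, hj, hk, hvj, hvk, hui, hvi] at hj3 hk3 hi3 ⊢ <;> nlinarith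
  · subst h
    simp only [sub_self] at key
    norm_num at key
    linarith

theorem avg_eq_one_iff {n : ℕ} (hn : 0 < n) (f : Fin n → Fin n → ℝ) (hf : ∀ i j, f i j ≤ 1) :
    (1 / (n : ℝ) ^ 2) * ∑ i, ∑ j, f i j = 1 ↔ ∀ i j, f i j = 1 := by
  have hn' : (n : ℝ) ≠ 0 := by exact_mod_cast hn.ne'
  have e : ∑ i, ∑ j, (1 - f i j) = (n : ℝ) ^ 2 - ∑ i, ∑ j, f i j := by
    simp [Finset.sum_sub_distrib, pow_two]
  constructor
  · intro h i j
    have h1 : ∑ i, ∑ j, f i j = (n : ℝ) ^ 2 := by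
      field_simp at h
      exact h
    rw [h1, sub_self] at e
    have h2 := (Finset.sum_eq_zero_iff_of_nonneg (fun i _ =>
      Finset.sum_nonneg fun j _ => sub_nonneg.2 (hf i j))).1 e i (Finset.mem_univ _)
    have h3 := (Finset.sum_eq_zero_iff_of_nonneg (fun j _ =>
      sub_nonneg.2 (hf i j))).1 h2 j (Finset.mem_univ _)
    linarith
  · intro h
    simp only [h]
    simp
    field_simp

theorem pccAgr_eq_one_iff_and_pccPlusAgr_eq_one_iff {m n : ℕ} (hn : 0 < n)
    (V : Fin n → Fin m → Bool)
    (hne : ∀ i : Fin n, (∃ j, V i j = true) ∧ (∃ j, V i j = false)) :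
    (pccAgr V = 1 ↔ IsIdentity V) ∧ (pccPlusAgr V = 1 ↔ IsIdentity V) := by
  have K := fun i i' => pcc_key (V i) (V i') (hne i).1 (hne i).2 (hne i').1 (hne i').2
  constructor
  · unfold pccAgr IsIdentity
    rw [avg_eq_one_iff hn _ fun i j => (K i j).1]
    exact forall₂_congr fun i j => (K i j).2
  · unfold pccPlusAgr IsIdentity
    rw [avg_eq_one_iff hn _ fun i j => max_le zero_le_one (K i j).1]
    refine forall₂_congr fun i j => ?_
    rw [← (K i j).2]
    constructor
    · intro h
      rcases max_choice 0 (pcc (toReal (V i)) (toReal (V j))) with h' | h'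
      · rw [h'] at h; norm_num at h
      · rw [h'] at h; exact h
    · intro h
      rw [h]; norm_num
end

section
/- Let k ≥ 2 and let E=(C,V) be a k-Party election with m candidates and n voters such that k divides both m and n. Then pcc-agr(E) = 0 and pcc⁺-agr(E) = 1/k. -/
open Finset

lemma kp_centered_sum {k s : ℕ} (hk : 2 ≤ k) (f : Fin (k * s) → Fin k)
    (hf : ∀ a : Fin k, (Finset.univ.filter (fun c => f c = a)).card = s) (a b : Fin k) :
    ∑ c, ((if a = f c then (1:ℝ) else 0) - 1 / k) * ((if b = f c then (1:ℝ) else 0) - 1 / k)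
      = (if a = b then (s:ℝ) else 0) - s / k := by
  have hk0 : (k:ℝ) ≠ 0 := by positivity
  have h1 : ∀ a : Fin k, ∑ c, (if a = f c then (1:ℝ) else 0) = s := by
    intro a
    rw [Finset.sum_boole]
    simp only [eq_comm (a := a)]
    rw [hf]
  have h2 : ∀ c, ((if a = f c then (1:ℝ) else 0) - 1 / k) * ((if b = f c then (1:ℝ) else 0) - 1 / k)
      = (if a = b then (if a = f c then (1:ℝ) else 0) else 0)
        - (1 / k) * (if a = f c then (1:ℝ) else 0) - (1 / k) * (if b = f c then (1:ℝ) else 0)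
        + 1 / k * (1 / k) := by
    intro c
    by_cases hab : a = b
    · subst hab
      by_cases h : a = f c <;> simp [h]; ring
    · by_cases h : a = f c
      · have : ¬ b = f c := fun h' => hab (h.trans h'.symm)
        rw [if_pos h, if_neg this, if_neg hab]; ring
      · rw [if_neg h, if_neg hab]; ring
  rw [Finset.sum_congr rfl (fun c _ => h2 c), Finset.sum_add_distrib, Finset.sum_sub_distrib,
    Finset.sum_sub_distrib, ← Finset.mul_sum, ← Finset.mul_sum, h1, h1]
  have h3 : ∑ c, (if a = b then (if a = f c then (1:ℝ) else 0) else 0)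
      = if a = b then (s:ℝ) else 0 := by
    split_ifs with h
    · exact h1 a
    · simp
  rw [h3]
  simp
  field_simp
  ring

lemma kp_pcc {k s : ℕ} (hk : 2 ≤ k) (hs : 0 < s) (f : Fin (k * s) → Fin k)
    (hf : ∀ a : Fin k, (Finset.univ.filter (fun c => f c = a)).card = s) (a b : Fin k) :
    pcc (fun c => if a = f c then (1:ℝ) else 0) (fun c => if b = f c then (1:ℝ) else 0)
      = if a = b then 1 else -1 / ((k:ℝ) - 1) := by
  have hk2 : (2:ℝ) ≤ k := by exact_mod_cast hk
  have hk0 : (k:ℝ) ≠ 0 := by positivity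
  have hk1 : (k:ℝ) - 1 ≠ 0 := by linarith
  have hs0 : (0:ℝ) < s := by exact_mod_cast hs
  have h1 : ∀ a : Fin k, (∑ c, (if a = f c then (1:ℝ) else 0)) / ((k * s : ℕ) : ℝ) = 1 / k := by
    intro a
    rw [Finset.sum_boole]
    simp only [eq_comm (a := a)]
    rw [hf]
    push_cast
    field_simp
  have hpos : (0:ℝ) < s - s / k := by
    rw [sub_pos, div_lt_iff₀ (by linarith)]
    nlinarith
  have hsq : ∀ a : Fin k, ∑ c, ((if a = f c then (1:ℝ) else 0) - 1 / k) ^ 2 = (s:ℝ) - s / k := by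
    intro a
    simp only [pow_two]
    rw [kp_centered_sum hk f hf a a, if_pos rfl]
  unfold pcc
  simp only [h1, hsq, kp_centered_sum hk f hf a b]
  rw [if_neg (by simp [(Real.sqrt_pos.2 hpos).ne']), Real.mul_self_sqrt hpos.le]
  split_ifs with h
  · exact div_self hpos.ne'
  · rw [div_eq_div_iff hpos.ne' hk1]
    field_simp
    ring

lemma kp_sum {k t : ℕ} (g : Fin (k * t) → Fin k)
    (hg : ∀ a : Fin k, (Finset.univ.filter (fun i => g i = a)).card = t) (a : Fin k) (y : ℝ) :
    ∑ i, (if a = g i then (1:ℝ) else y) = t + (k * t - t) * y := by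
  have h : ∀ i, (if a = g i then (1:ℝ) else y) = (if a = g i then 1 else 0) * (1 - y) + y := by
    intro i; split_ifs <;> ring
  rw [Finset.sum_congr rfl (fun c _ => h c), Finset.sum_add_distrib, ← Finset.sum_mul,
    Finset.sum_boole]
  simp only [eq_comm (a := a)]
  rw [hg]
  simp
  ring

/-- for a `k`-Party election (with `k` dividing the numbers of candidates
and voters), `pcc-agr(E) = 0` and `pcc⁺-agr(E) = 1/k`.  The candidates `Fin (k * s)` are
partitioned into `k` groups of size `s` by `f`, the voters `Fin (k * t)` into `k` groups
of size `t` by `g`, and a voter approves a candidate iff they are in matching groups. -/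
theorem kParty_pccAgr_and_pccPlusAgr {k s t : ℕ} (hk : 2 ≤ k) (hs : 0 < s) (ht : 0 < t)
    (f : Fin (k * s) → Fin k) (g : Fin (k * t) → Fin k)
    (hf : ∀ a : Fin k, (Finset.univ.filter (fun c => f c = a)).card = s)
    (hg : ∀ a : Fin k, (Finset.univ.filter (fun i => g i = a)).card = t)
    (V : Fin (k * t) → Fin (k * s) → Bool)
    (hV : ∀ i c, V i c = true ↔ g i = f c) :
    pccAgr V = 0 ∧ pccPlusAgr V = 1 / (k : ℝ) := by
  have hk2 : (2:ℝ) ≤ k := by exact_mod_cast hk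
  have hk0 : (k:ℝ) ≠ 0 := by positivity
  have hk1 : (0:ℝ) < (k:ℝ) - 1 := by linarith
  have ht0 : (t:ℝ) ≠ 0 := by positivity
  have hR : ∀ i, toReal (V i) = fun c => if g i = f c then (1:ℝ) else 0 := by
    intro i
    funext c
    simp only [toReal, hV]
  constructor
  · unfold pccAgr
    simp only [hR, kp_pcc hk hs f hf, kp_sum g hg]
    have : (t:ℝ) + (k * t - t) * (-1 / ((k:ℝ) - 1)) = 0 := by
      have := hk1.ne'
      field_simp
      ring
    simp [this]
  · unfold pccPlusAgr
    have hm : ∀ a b : Fin k, max 0 (if a = b then 1 else -1 / ((k:ℝ) - 1))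
        = if a = b then (1:ℝ) else 0 := by
      intro a b
      split_ifs
      · simp
      · exact max_eq_left (div_nonpos_of_nonpos_of_nonneg (by norm_num) hk1.le)
    simp only [hR, kp_pcc hk hs f hf, hm, kp_sum g hg]
    simp
    field_simp
end

section
/- Let E=(C,V) be an approval election with m candidates such that 0 < |A(u)| = |A(v)| < m for all votes u, v ∈ V (all voters approve the same number of candidates, which is neither 0 nor m). Then pair-agr(E) = pcc-agr(E). -/
open Finset

theorem sum_toReal_aux {m : ℕ} (v : Fin m → Bool) : ∑ j, toReal v j = (voteLen v : ℝ) := by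
  simp [toReal, voteLen]

theorem hamm_aux {m : ℕ} (u v : Fin m → Bool) :
    (hamm u v : ℝ) = voteLen u + voteLen v - 2 * ∑ j, toReal u j * toReal v j := by
  rw [← sum_toReal_aux, ← sum_toReal_aux, Finset.mul_sum, ← Finset.sum_add_distrib,
    ← Finset.sum_sub_distrib]
  unfold hamm
  rw [Finset.card_filter]
  push_cast
  refine Finset.sum_congr rfl fun j _ => ?_
  unfold toReal
  cases u j <;> cases v j <;> norm_num

theorem cov_aux {m : ℕ} (x y : Fin m → ℝ) (a : ℝ) :
    ∑ i, (x i - a) * (y i - a) =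
      ∑ i, x i * y i - a * ∑ i, x i - a * ∑ i, y i + m * a ^ 2 := by
  have h : ∀ i, (x i - a) * (y i - a) = x i * y i - a * x i - a * y i + a ^ 2 := fun i => by ring
  simp only [h, Finset.sum_add_distrib, Finset.sum_sub_distrib, ← Finset.mul_sum]
  simp

theorem var_aux {m L : ℕ} (hm : 0 < m) (v : Fin m → Bool) (hv : voteLen v = L) :
    ∑ i, (toReal v i - (L : ℝ) / m) ^ 2 = L - (L : ℝ) ^ 2 / m := by
  have hm' : (m : ℝ) ≠ 0 := by positivity
  have h : ∀ i, toReal v i * toReal v i = toReal v i := fun i => by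
    unfold toReal; split_ifs <;> norm_num
  simp only [pow_two (toReal v _ - (L : ℝ) / m)]
  rw [cov_aux]
  simp only [h, sum_toReal_aux, hv]
  field_simp
  ring

theorem pcc_aux_s12 {m L : ℕ} (hL0 : 0 < L) (hLm : L < m) (u v : Fin m → Bool)
    (hu : voteLen u = L) (hv : voteLen v = L) :
    pcc (toReal u) (toReal v) = 1 - (hamm u v : ℝ) / (2 * (L - (L : ℝ) ^ 2 / m)) := by
  have hm : 0 < m := by omega
  have hm' : (0 : ℝ) < m := by positivity
  have hL' : (0 : ℝ) < L := by positivity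
  have hlt : (L : ℝ) < m := by exact_mod_cast hLm
  have hD : (0 : ℝ) < L - (L : ℝ) ^ 2 / m := by
    rw [sub_pos, div_lt_iff₀ hm']
    nlinarith
  have hs := Real.sqrt_pos.mpr hD
  unfold pcc
  simp only [sum_toReal_aux, hu, hv]
  rw [var_aux hm u hu, var_aux hm v hv, if_neg (by simp [hs.ne']), Real.mul_self_sqrt hD.le,
    cov_aux, hamm_aux]
  simp only [sum_toReal_aux, hu, hv]
  have e : (m : ℝ) * ((L : ℝ) / m) ^ 2 = (L : ℝ) / m * L := by field_simp
  have e2 : (L : ℝ) ^ 2 / m = (L : ℝ) / m * L := by ring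
  rw [e]
  rw [e2] at hD ⊢
  generalize (L : ℝ) / m * L = q at *
  have : (L : ℝ) - q ≠ 0 := hD.ne'
  field_simp
  ring

/-- if all voters approve the same number `L` of candidates with
`0 < L < m`, then `pair-agr(E) = pcc-agr(E)`. -/
theorem pairAgr_eq_pccAgr {m n L : ℕ} (hn : 0 < n) (V : Fin n → Fin m → Bool)
    (hL0 : 0 < L) (hLm : L < m) (hV : ∀ i : Fin n, voteLen (V i) = L) :
    pairAgr V = pccAgr V := by
  have hn' : (0 : ℝ) < n := by exact_mod_cast hn
  have hm' : (0 : ℝ) < m := by exact_mod_cast (by omega : 0 < m)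
  have hs : satr V = (L : ℝ) / m := by
    unfold satr avl
    simp only [hV]
    simp
    field_simp
  have hd : 2 * (n : ℝ) ^ 2 * (m : ℝ) * satr V * (1 - satr V) =
      (n : ℝ) ^ 2 * (2 * (L - (L : ℝ) ^ 2 / m)) := by
    rw [hs]
    field_simp
  unfold pairAgr pccAgr
  rw [hd]
  simp only [pcc_aux_s12 hL0 hLm _ _ (hV _) (hV _), Finset.sum_sub_distrib, ← Finset.sum_div]
  simp only [Finset.sum_const, Finset.card_univ, Fintype.card_fin, nsmul_eq_mul, mul_one]
  generalize 2 * ((L : ℝ) - (L : ℝ) ^ 2 / m) = D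
  rw [mul_comm ((n : ℝ) ^ 2) D, ← div_div]
  generalize (∑ i, ∑ j, (hamm (V i) (V j) : ℝ)) / D = T
  field_simp
end

section
/- Let C be a candidate set of size m, let a, b be nonnegative integers with a+b > 0 and p = a/(a+b), let q ∈ {0, 1/m, 2/m, ..., 1}, and let v ∈ {0,1}^m be a vote with exactly q·m ones. Then the average, over all votes u in the multiset p-U_C (counted with multiplicity), of the normalized Hamming distance ham(v,u)/m equals p·(1−q) + q·(1−p). -/
open Finset

lemma aux_weight {m : ℕ} (a b : ℝ) (u : Fin m → Bool) :
    a ^ voteLen u * b ^ (m - voteLen u) = ∏ i, (if u i = true then a else b) := by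
  rw [Finset.prod_ite, Finset.prod_const, Finset.prod_const]
  have h := Finset.card_filter_add_card_filter_not (s := (Finset.univ : Finset (Fin m)))
    (fun i => u i = true)
  rw [Finset.card_univ, Fintype.card_fin] at h
  have h2 : m - voteLen u = (Finset.univ.filter (fun i => ¬ u i = true)).card := by
    unfold voteLen; omega
  rw [h2]; rfl

lemma aux_coord {m : ℕ} (a b : ℝ) (v : Fin m → Bool) (j : Fin m) :
    ∑ u : Fin m → Bool, (∏ i, (if u i = true then a else b)) * (if v j ≠ u j then (1 : ℝ) else 0)
      = (if v j = true then b else a) * (a + b) ^ (m - 1) := by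
  have h1 : ∀ u : Fin m → Bool,
      (∏ i, (if u i = true then a else b)) * (if v j ≠ u j then (1 : ℝ) else 0)
      = ∏ i, ((if u i = true then a else b) *
          (if i = j then (if v j ≠ u i then (1 : ℝ) else 0) else 1)) := by
    intro u
    rw [Finset.prod_mul_distrib, Finset.prod_ite_eq' Finset.univ j]
    simp
  rw [Finset.sum_congr rfl (fun u _ => h1 u)]
  rw [← Fintype.prod_sum (fun (i : Fin m) (x : Bool) => (if x = true then a else b) *
          (if i = j then (if v j ≠ x then (1 : ℝ) else 0) else 1))]
  rw [← Finset.mul_prod_erase Finset.univ _ (Finset.mem_univ j)]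
  congr 1
  · cases h : v j <;> simp
  · rw [Finset.prod_congr rfl (g := fun _ => a + b)]
    · simp
    · intro i hi
      simp [Finset.ne_of_mem_erase hi]

/-- the average normalized Hamming distance between a vote `v` with
`q·m` ones and the multiset `p-U_C` (in which each vote with `r` ones has multiplicity
`a^r·b^(m-r)`, `p = a/(a+b)`) equals `p(1-q) + q(1-p)`. -/
theorem avg_ham_to_pUC {m : ℕ} (hm : 0 < m) (a b : ℕ) (hab : 0 < a + b)
    (p q : ℝ) (hp : p = (a : ℝ) / ((a : ℝ) + (b : ℝ)))
    (v : Fin m → Bool) (hq : (voteLen v : ℝ) = q * m) :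
    (∑ u : Fin m → Bool,
        ((a : ℝ) ^ voteLen u * (b : ℝ) ^ (m - voteLen u)) * (hamm v u : ℝ)) /
      ((m : ℝ) * ((a : ℝ) + (b : ℝ)) ^ m) = p * (1 - q) + q * (1 - p) := by
  have hs : (0 : ℝ) < (a : ℝ) + b := by exact_mod_cast hab
  have hm' : (0 : ℝ) < m := by exact_mod_cast hm
  have key : (∑ u : Fin m → Bool,
        ((a : ℝ) ^ voteLen u * (b : ℝ) ^ (m - voteLen u)) * (hamm v u : ℝ))
      = (q * m * b + (m - q * m) * a) * ((a : ℝ) + b) ^ (m - 1) := by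
    have h1 : ∀ u : Fin m → Bool,
        ((a : ℝ) ^ voteLen u * (b : ℝ) ^ (m - voteLen u)) * (hamm v u : ℝ)
        = ∑ j, (∏ i, (if u i = true then (a : ℝ) else b)) *
            (if v j ≠ u j then (1 : ℝ) else 0) := by
      intro u
      rw [aux_weight, ← Finset.mul_sum, hamm, Finset.card_filter]
      push_cast
      rfl
    rw [Finset.sum_congr rfl (fun u _ => h1 u), Finset.sum_comm,
      Finset.sum_congr rfl (fun j _ => aux_coord (a : ℝ) b v j), ← Finset.sum_mul]
    congr 1
    have h2 : ∀ j, (if v j = true then (b : ℝ) else a)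
        = a + (if v j = true then (1 : ℝ) else 0) * (b - a) := by
      intro j; split_ifs <;> ring
    rw [Finset.sum_congr rfl (fun j _ => h2 j), Finset.sum_add_distrib, ← Finset.sum_mul,
      Finset.sum_boole]
    change _ + (voteLen v : ℝ) * _ = _
    rw [hq]
    simp
    ring
  rw [key, hp]
  obtain ⟨k, rfl⟩ : ∃ k, m = k + 1 := ⟨m - 1, by omega⟩
  rw [Nat.add_sub_cancel, pow_succ]
  field_simp
  ring
end

section
/- Let E=(C,V) be an approval election with m candidates and n voters, and let p = satr(E) with 0 < p < 1, written as p = a/(a+b) for nonnegative integers a, b with a+b > 0. Then 0 ≤ ĥam(V, p-U_C) ≤ 2p(1−p), where ĥam is the matched normalized Hamming distance; consequently the Outer Diversity index out-div(E) = 1 − ĥam(V, p-U_C)/(2p(1−p)) satisfies 0 ≤ out-div(E) ≤ 1. -/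
open Finset

lemma od_sum_mod {M A B : ℕ} (h : M = A * B) (hB : 0 < B) (g : Fin B → ℕ) :
    ∑ i : Fin M, g ⟨i.val % B, Nat.mod_lt _ hB⟩ = A * ∑ y, g y := by
  subst h
  rw [← Equiv.sum_comp finProdFinEquiv, Fintype.sum_prod_type]
  have : ∀ (x : Fin A) (y : Fin B),
      (⟨(finProdFinEquiv (x, y)).val % B, Nat.mod_lt _ hB⟩ : Fin B) = y := by
    intro x y
    apply Fin.ext
    simp [finProdFinEquiv, Nat.mod_eq_of_lt y.2]
  simp only [this]
  simp

lemma od_exists_shift {M : ℕ} (hM : 0 < M) (F : Fin M → Fin M → ℕ) :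
    ∃ π : Equiv.Perm (Fin M), M * ∑ i, F i (π i) ≤ ∑ i, ∑ j, F i j := by
  have : NeZero M := ⟨hM.ne'⟩
  by_contra! hc
  have h1 : ∑ t : Fin M, ∑ i, F i (Equiv.addRight t i) = ∑ i, ∑ j, F i j := by
    rw [Finset.sum_comm]
    refine Finset.sum_congr rfl fun i _ => ?_
    exact Equiv.sum_comp (Equiv.addLeft i) (F i)
  have h2 : ∑ t : Fin M, (∑ i, ∑ j, F i j) < ∑ t : Fin M, M * ∑ i, F i (Equiv.addRight t i) :=
    Finset.sum_lt_sum_of_nonempty ⟨0, Finset.mem_univ _⟩ fun t _ => hc _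
  rw [← Finset.mul_sum, h1] at h2
  simp at h2

lemma od_min_le {m k N : ℕ} (hk : 0 < k) (hN : 0 < N)
    (U : Fin k → Fin m → Bool) (W : Fin N → Fin m → Bool) :
    mHam k N hk hN U W ≤ ((∑ x, ∑ y, hamm (U x) (W y) : ℕ) : ℝ) / ((k : ℝ) * N * m) := by
  unfold mHam
  gcongr
  obtain ⟨π, hπ⟩ := od_exists_shift (Nat.mul_pos hk hN)
    (fun i j => hamm (U ⟨i.val % k, Nat.mod_lt _ hk⟩) (W ⟨j.val % N, Nat.mod_lt _ hN⟩))
  refine (Finset.inf'_le _ (Finset.mem_univ π)).trans ?_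
  have e1 : ∀ i : Fin (k * N), ∑ j : Fin (k * N),
      hamm (U ⟨i.val % k, Nat.mod_lt _ hk⟩) (W ⟨j.val % N, Nat.mod_lt _ hN⟩)
      = k * ∑ y, hamm (U ⟨i.val % k, Nat.mod_lt _ hk⟩) (W y) := fun i =>
    od_sum_mod rfl hN (fun y => hamm (U ⟨i.val % k, Nat.mod_lt _ hk⟩) (W y))
  simp only [e1] at hπ
  rw [od_sum_mod (Nat.mul_comm k N) hk (fun x => k * ∑ y, hamm (U x) (W y)),
    ← Finset.mul_sum, ← mul_assoc, Nat.mul_comm N k] at hπ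
  exact Nat.le_of_mul_le_mul_left hπ (Nat.mul_pos hk hN)

lemma od_prod_weight {m : ℕ} (a b : ℕ) (u : Fin m → Bool) :
    a ^ voteLen u * b ^ (m - voteLen u) = ∏ i, (if u i = true then a else b) := by
  rw [Finset.prod_ite, Finset.prod_const, Finset.prod_const]
  have := Finset.card_filter_add_card_filter_not (s := (Finset.univ : Finset (Fin m)))
    (fun i => u i = true)
  rw [Finset.card_univ, Fintype.card_fin] at this
  unfold voteLen
  congr 2
  omega

lemma od_count {m a b : ℕ} (W : Fin ((a + b) ^ m) → Fin m → Bool)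
    (hW : ∀ u : Fin m → Bool,
      (Finset.univ.filter (fun i => W i = u)).card
        = a ^ voteLen u * b ^ (m - voteLen u)) (j : Fin m) (t : Bool) :
    (Finset.univ.filter (fun y => t ≠ W y j)).card
      = (if t = true then b else a) * (a + b) ^ (m - 1) := by
  have h1 : (Finset.univ.filter (fun y => t ≠ W y j)).card
      = ∑ u : Fin m → Bool, ((Finset.univ.filter (fun y => t ≠ W y j)).filter
          (fun y => W y = u)).card :=
    Finset.card_eq_sum_card_fiberwise (fun _ _ => Finset.mem_univ _)
  have h2 : ∀ u : Fin m → Bool, ((Finset.univ.filter (fun y => t ≠ W y j)).filter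
          (fun y => W y = u)).card
      = ∏ i, (if i = j ∧ t = u i then 0 else if u i = true then a else b) := by
    intro u
    by_cases h : t = u j
    · rw [Finset.prod_eq_zero (Finset.mem_univ j) (by simp [h]), Finset.card_eq_zero]
      ext y
      simp only [Finset.mem_filter, Finset.mem_univ, true_and, Finset.notMem_empty, iff_false]
      rintro ⟨h3, rfl⟩
      exact h3 h
    · have : (Finset.univ.filter (fun y => t ≠ W y j)).filter (fun y => W y = u)
          = Finset.univ.filter (fun y => W y = u) := by
        ext y
        simp only [Finset.mem_filter, Finset.mem_univ, true_and, and_iff_right_iff_imp]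
        rintro rfl
        exact h
      rw [this, hW, od_prod_weight]
      refine Finset.prod_congr rfl fun i _ => ?_
      have hne : ¬ (i = j ∧ t = u i) := by
        rintro ⟨rfl, h'⟩
        exact h h'
      rw [if_neg hne]
  rw [h1, Finset.sum_congr rfl fun u _ => h2 u]
  have h3 := Finset.prod_univ_sum (fun _ : Fin m => (Finset.univ : Finset Bool))
    (fun i c => if i = j ∧ t = c then 0 else if c = true then a else b)
  rw [Fintype.piFinset_univ] at h3
  rw [← h3, ← Finset.mul_prod_erase _ _ (Finset.mem_univ j)]
  congr 1
  · cases t <;> simp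
  · rw [Finset.prod_congr rfl (g := fun _ => a + b), Finset.prod_const,
      Finset.card_erase_of_mem (Finset.mem_univ j), Finset.card_univ, Fintype.card_fin]
    intro i hi
    simp [Finset.ne_of_mem_erase hi]

lemma od_row {m a b : ℕ} (W : Fin ((a + b) ^ m) → Fin m → Bool)
    (hW : ∀ u : Fin m → Bool,
      (Finset.univ.filter (fun i => W i = u)).card
        = a ^ voteLen u * b ^ (m - voteLen u)) (v : Fin m → Bool) :
    ((∑ y, hamm v (W y) : ℕ) : ℝ)
      = (voteLen v * b + (m - voteLen v) * a) * ((a : ℝ) + b) ^ (m - 1) := by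
  have h1 : ∑ y, hamm v (W y) = ∑ j, (Finset.univ.filter (fun y => v j ≠ W y j)).card := by
    simp only [hamm, Finset.card_filter]
    exact Finset.sum_comm
  rw [h1, Finset.sum_congr rfl fun j _ => od_count W hW j (v j), ← Finset.sum_mul,
    Finset.sum_ite, Finset.sum_const, Finset.sum_const]
  have := Finset.card_filter_add_card_filter_not (s := (Finset.univ : Finset (Fin m)))
    (fun i => v i = true)
  rw [Finset.card_univ, Fintype.card_fin] at this
  have h2 : ((Finset.univ.filter (fun i => ¬ v i = true)).card : ℝ) = m - voteLen v := by
    have h3 : (voteLen v : ℝ) + ((Finset.univ.filter (fun i => ¬ v i = true)).card : ℝ) = m := by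
      exact_mod_cast this
    linarith
  simp only [nsmul_eq_mul, Nat.cast_id]
  push_cast
  rw [h2]
  rfl

/-- `0 ≤ ĥam(V, p-U_C) ≤ 2p(1-p)`, and consequently the Outer Diversity
index `out-div(E) = 1 - ĥam(V, p-U_C)/(2p(1-p))` lies in `[0,1]`.  The multiset
`p-U_C` is represented by any enumeration `W` in which each vote with `r` ones
appears exactly `a^r·b^(m-r)` times, where `p = a/(a+b)`. -/
theorem outDiv_bounds {m n a b : ℕ} (hm : 0 < m) (hn : 0 < n)
    (V : Fin n → Fin m → Bool) (p : ℝ) (hab : 0 < a + b)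
    (hp : p = (a : ℝ) / ((a : ℝ) + (b : ℝ))) (hsat : satr V = p)
    (hp0 : 0 < p) (hp1 : p < 1)
    (W : Fin ((a + b) ^ m) → Fin m → Bool)
    (hW : ∀ u : Fin m → Bool,
      (Finset.univ.filter (fun i => W i = u)).card
        = a ^ voteLen u * b ^ (m - voteLen u)) :
    0 ≤ mHam n ((a + b) ^ m) hn (pow_pos hab m) V W ∧
    mHam n ((a + b) ^ m) hn (pow_pos hab m) V W ≤ 2 * p * (1 - p) ∧
    0 ≤ 1 - mHam n ((a + b) ^ m) hn (pow_pos hab m) V W / (2 * p * (1 - p)) ∧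
    1 - mHam n ((a + b) ^ m) hn (pow_pos hab m) V W / (2 * p * (1 - p)) ≤ 1 := by
  have hA0 : 0 ≤ mHam n ((a + b) ^ m) hn (pow_pos hab m) V W := by
    unfold mHam; positivity
  have hs : (0 : ℝ) < (a : ℝ) + b := by exact_mod_cast hab
  have hnR : (0 : ℝ) < n := by exact_mod_cast hn
  have hmR : (0 : ℝ) < m := by exact_mod_cast hm
  have hq : 0 < 2 * p * (1 - p) := by
    have : 0 < 1 - p := by linarith
    positivity
  have hA1 : mHam n ((a + b) ^ m) hn (pow_pos hab m) V W ≤ 2 * p * (1 - p) := by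
    refine (od_min_le hn (pow_pos hab m) V W).trans (le_of_eq ?_)
    have hL : ∑ x, (voteLen (V x) : ℝ) = p * m * n := by
      rw [← hsat]; unfold satr avl; field_simp
    rw [Nat.cast_sum, Finset.sum_congr rfl fun x _ => od_row W hW (V x), ← Finset.sum_mul,
      Finset.sum_add_distrib, ← Finset.sum_mul, ← Finset.sum_mul, Finset.sum_sub_distrib, hL]
    obtain ⟨m', rfl⟩ : ∃ m', m = m' + 1 := ⟨m - 1, by omega⟩
    have ha : (a : ℝ) = p * (a + b) := by rw [hp]; field_simp
    have hb : (b : ℝ) = (1 - p) * (a + b) := by linarith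
    have hpw : ((a : ℝ) + b) ^ m' ≠ 0 := by positivity
    simp only [Finset.sum_const, Finset.card_univ, Fintype.card_fin, nsmul_eq_mul]
    push_cast at hmR ⊢
    rw [div_eq_iff (by positivity), pow_succ]
    linear_combination (p * (m' + 1) * n * ((a : ℝ) + b) ^ m') * hb
      + ((1 - p) * (m' + 1) * n * ((a : ℝ) + b) ^ m') * ha
  have hd : mHam n ((a + b) ^ m) hn (pow_pos hab m) V W / (2 * p * (1 - p)) ≤ 1 :=
    (div_le_one hq).2 hA1
  have hd0 := div_nonneg hA0 hq.le
  exact ⟨hA0, hA1, by linarith, by linarith⟩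
end

section
/- Let U=(u_1,...,u_k) and V=(v_1,...,v_n) be two collections of votes over the same set of m candidates, and let t be a positive integer. Let t·V denote the collection consisting of t copies of each vote of V (so t·V has t·n votes). Then ĥam(U, t·V) = ĥam(U, V), where ĥam is the matched normalized Hamming distance. -/
open Finset

open Classical in
lemma copies_lower {A : Type} [Fintype A] (t : ℕ) (ht : 0 < t) (c : A → A → ℕ) (C : ℕ)
    (hC : ∀ σ : Equiv.Perm A, C ≤ ∑ a, c a (σ a)) (π : Equiv.Perm (Fin t × A)) :
    t * C ≤ ∑ x, c x.2 (π x).2 := by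
  have ht' : (0 : ℝ) < t := by exact_mod_cast ht
  have key : ∀ f : A → ℝ, ∑ x : Fin t × A, f x.2 = t * ∑ a, f a := by
    intro f
    rw [Fintype.sum_prod_type]
    simp
  have keyπ : ∀ f : A → ℝ, ∑ x : Fin t × A, f (π x).2 = t * ∑ a, f a := by
    intro f
    rw [← key f]
    exact Equiv.sum_comp π (fun x => f x.2)
  let M : Matrix A A ℝ := fun a b =>
    (∑ x : Fin t × A, if x.2 = a ∧ (π x).2 = b then (1 : ℝ) else 0) / t
  have hM : M ∈ doublyStochastic ℝ A := by
    rw [mem_doublyStochastic_iff_sum]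
    refine ⟨fun a b => ?_, fun a => ?_, fun b => ?_⟩
    · apply div_nonneg _ ht'.le
      exact Finset.sum_nonneg fun x _ => by split_ifs <;> norm_num
    · simp only [M]
      rw [← Finset.sum_div, Finset.sum_comm, div_eq_one_iff_eq ht'.ne']
      have := key (fun b => if b = a then (1 : ℝ) else 0)
      simp only [ite_and]
      simpa using this
    · simp only [M]
      rw [← Finset.sum_div, Finset.sum_comm, div_eq_one_iff_eq ht'.ne']
      have := keyπ (fun a => if a = b then (1 : ℝ) else 0)
      simp only [ite_and]
      simpa using this
  obtain ⟨w, hw0, hw1, hwM⟩ := exists_eq_sum_perm_of_mem_doublyStochastic hM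
  have h1 : ∑ a, ∑ b, M a b * (c a b : ℝ) = (∑ x, (c x.2 (π x).2 : ℝ)) / t := by
    simp only [M, div_mul_eq_mul_div, ← Finset.sum_div, Finset.sum_mul]
    congr 1
    have : ∀ a, ∑ b, ∑ x : Fin t × A,
        (if x.2 = a ∧ (π x).2 = b then (1 : ℝ) else 0) * (c a b : ℝ)
        = ∑ x : Fin t × A, if x.2 = a then (c x.2 (π x).2 : ℝ) else 0 := by
      intro a
      rw [Finset.sum_comm]
      refine Finset.sum_congr rfl fun x _ => ?_
      by_cases h : x.2 = a
      · subst h; simp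
      · simp [h]
    simp only [this]
    rw [Finset.sum_comm]
    simp
  have h2 : ∑ a, ∑ b, M a b * (c a b : ℝ) = ∑ σ, w σ * ∑ a, (c a (σ a) : ℝ) := by
    have : ∀ a b, M a b = ∑ σ, w σ * (if σ a = b then 1 else 0) := by
      intro a b
      rw [← hwM, Matrix.sum_apply]
      refine Finset.sum_congr rfl fun σ _ => ?_
      simp [Equiv.Perm.permMatrix, PEquiv.toMatrix_apply, Equiv.toPEquiv_apply, eq_comm]
    have h3 : ∀ a, ∑ b, M a b * (c a b : ℝ) = ∑ σ, w σ * (c a (σ a) : ℝ) := by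
      intro a
      simp only [this, Finset.sum_mul]
      rw [Finset.sum_comm]
      refine Finset.sum_congr rfl fun σ _ => ?_
      simp
    simp only [h3]
    rw [Finset.sum_comm]
    simp only [Finset.mul_sum]
  have h4 : (C : ℝ) ≤ ∑ σ, w σ * ∑ a, (c a (σ a) : ℝ) := by
    calc (C : ℝ) = ∑ σ, w σ * (C : ℝ) := by rw [← Finset.sum_mul, hw1, one_mul]
      _ ≤ _ := Finset.sum_le_sum fun σ _ =>
        mul_le_mul_of_nonneg_left (by exact_mod_cast hC σ) (hw0 σ)
  rw [← h2, h1, le_div_iff₀ ht'] at h4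
  have : ((t * C : ℕ) : ℝ) ≤ ((∑ x, c x.2 (π x).2 : ℕ) : ℝ) := by
    push_cast
    linarith
  exact_mod_cast this

/-- duplicating every vote of the second collection `t` times does not
change the matched normalized Hamming distance. -/
theorem mHam_copies {m k n t : ℕ} (hk : 0 < k) (hn : 0 < n) (ht : 0 < t)
    (U : Fin k → Fin m → Bool) (V : Fin n → Fin m → Bool) :
    mHam k (t * n) hk (Nat.mul_pos ht hn) U
      (fun i => V ⟨i.val % n, Nat.mod_lt _ hn⟩) = mHam k n hk hn U V := by
  classical
  let c : Fin (k * n) → Fin (k * n) → ℕ := fun a b =>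
    hamm (U ⟨a.val % k, Nat.mod_lt _ hk⟩) (V ⟨b.val % n, Nat.mod_lt _ hn⟩)
  have hcard : t * (k * n) = k * (t * n) := by ring
  let e : Fin t × Fin (k * n) ≃ Fin (k * (t * n)) := finProdFinEquiv.trans (finCongr hcard)
  have he : ∀ x, (e x).val = x.2.val + k * n * x.1.val := fun x => by simp [e]
  have hek : ∀ x, (e x).val % k = x.2.val % k := fun x => by
    rw [he, mul_assoc, Nat.add_mul_mod_self_left]
  have hen : ∀ x, (e x).val % (t * n) % n = x.2.val % n := fun x => by
    rw [Nat.mod_mul_left_mod, he, mul_right_comm k n, Nat.add_mul_mod_self_right]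
  have hcost : ∀ π : Equiv.Perm (Fin (k * (t * n))),
      ∑ i, hamm (U ⟨i.val % k, Nat.mod_lt _ hk⟩)
        (V ⟨(π i).val % (t * n) % n, Nat.mod_lt _ hn⟩)
      = ∑ x, c x.2 (e.symm (π (e x))).2 := by
    intro π
    rw [← Equiv.sum_comp e]
    refine Finset.sum_congr rfl fun x _ => ?_
    have h2 := hen (e.symm (π (e x)))
    rw [Equiv.apply_symm_apply] at h2
    simp only [c, hek, h2]
  have hmin : (Finset.univ.inf' ⟨Equiv.refl (Fin (k * (t * n))), Finset.mem_univ _⟩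
      (fun π : Equiv.Perm (Fin (k * (t * n))) =>
        ∑ i, hamm (U ⟨i.val % k, Nat.mod_lt _ hk⟩)
        (V ⟨(π i).val % (t * n) % n, Nat.mod_lt _ hn⟩)))
      = t * (Finset.univ.inf' ⟨Equiv.refl (Fin (k * n)), Finset.mem_univ _⟩
      (fun σ : Equiv.Perm (Fin (k * n)) => ∑ i, c i (σ i))) := by
    apply le_antisymm
    · obtain ⟨σ, -, hσ⟩ := Finset.exists_mem_eq_inf'
        (⟨Equiv.refl (Fin (k * n)), Finset.mem_univ _⟩ :
          (Finset.univ : Finset (Equiv.Perm (Fin (k * n)))).Nonempty)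
        (fun σ : Equiv.Perm (Fin (k * n)) => ∑ i, c i (σ i))
      rw [hσ]
      refine (Finset.inf'_le _ (Finset.mem_univ
        (e.symm.trans (((Equiv.refl (Fin t)).prodCongr σ).trans e)))).trans ?_
      rw [hcost, Fintype.sum_prod_type]
      simp
    · refine Finset.le_inf' _ _ fun π _ => ?_
      rw [hcost]
      exact copies_lower t ht c _ (fun σ => Finset.inf'_le _ (Finset.mem_univ σ))
        (e.trans (π.trans e.symm))
  have ht' : (t : ℝ) ≠ 0 := by exact_mod_cast ht.ne'
  unfold mHam
  rw [hmin]
  push_cast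
  rw [show (k : ℝ) * (t * n) * m = t * (k * n * m) by ring, mul_div_mul_left _ _ ht']
end

section
/- Fix positive integers m, n and a rational α ∈ [0,1] such that α·n·m is an integer, and let E=(C,V) be an approval election with m candidates, n voters, and satr(E) = α. Then chd(E) ≥ chd(E') for every approval election E' with m candidates, n voters, and saturation α if and only if at least one of the following holds: (a) there is a central vote in cen(E) approving all candidates; (b) there is a central vote in cen(E) disapproving all candidates; (c) for each candidate c ∈ C, |A(c)| ∈ {⌊n/2⌋, ⌈n/2⌉}. -/
open Finset

theorem score_eq_sum {m n : ℕ} (V : Fin n → Fin m → Bool) (c : Fin m) :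
    score V c = ∑ i : Fin n, if V i c = true then 1 else 0 := by
  rw [score, Finset.card_filter]

theorem sum_voteLen_eq {m n : ℕ} (V : Fin n → Fin m → Bool) :
    ∑ i : Fin n, voteLen (V i) = ∑ c : Fin m, score V c := by
  simp only [score_eq_sum, voteLen, Finset.card_filter]
  exact Finset.sum_comm

theorem score_le {m n : ℕ} (V : Fin n → Fin m → Bool) (c : Fin m) : score V c ≤ n := by
  have h := Finset.card_filter_le (Finset.univ : Finset (Fin n)) (fun i => V i c = true)
  simpa [score] using h

theorem chd_eq_sum {m n : ℕ} (V : Fin n → Fin m → Bool) :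
    chd V = ∑ c : Fin m, min (score V c) (n - score V c) := by
  simp only [chd, hamm, Finset.card_filter]
  rw [Finset.sum_comm]
  refine Finset.sum_congr rfl fun c _ => ?_
  have hcompl : score V c + (Finset.univ.filter (fun i => ¬ V i c = true)).card = n := by
    have h := Finset.card_filter_add_card_filter_not (s := (Finset.univ : Finset (Fin n)))
      (fun i => V i c = true)
    simpa [score] using h
  rw [← Finset.card_filter]
  by_cases h : n < 2 * score V c
  · have : (Finset.univ.filter (fun i => V i c ≠ centralVote V c)) =
        Finset.univ.filter (fun i => ¬ V i c = true) := by
      ext i; simp [centralVote, h]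
    rw [this]; omega
  · have : (Finset.univ.filter (fun i => V i c ≠ centralVote V c)).card = score V c := by
      unfold score
      congr 1
      ext i; simp [centralVote, h]
    rw [this]; omega

/-- Moving one approval from `b` to `a` in the vote of voter `i`. -/
def moveOne {m n : ℕ} (V : Fin n → Fin m → Bool) (i : Fin n) (a b : Fin m) :
    Fin n → Fin m → Bool :=
  fun i' c => if i' = i then (if c = a then true else if c = b then false else V i' c)
    else V i' c

theorem score_moveOne {m n : ℕ} (V : Fin n → Fin m → Bool) (i : Fin n) (a b : Fin m)
    (ha : V i a = false) (hb : V i b = true) (c : Fin m) :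
    score (moveOne V i a b) c + (if c = b then 1 else 0) =
      score V c + (if c = a then 1 else 0) := by
  rw [score_eq_sum, score_eq_sum,
    ← Finset.add_sum_erase _ _ (Finset.mem_univ i),
    ← Finset.add_sum_erase _ (fun i => if V i c = true then 1 else 0) (Finset.mem_univ i)]
  have h : ∑ x ∈ Finset.univ.erase i, (if moveOne V i a b x c = true then 1 else 0) =
      ∑ x ∈ Finset.univ.erase i, (if V x c = true then 1 else 0) := by
    refine Finset.sum_congr rfl fun x hx => ?_
    simp [moveOne, Finset.ne_of_mem_erase hx]
  rw [h]
  have hab : a ≠ b := by rintro rfl; simp_all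
  by_cases h1 : c = a
  · subst h1; simp [moveOne, ha, hab]; omega
  · by_cases h2 : c = b
    · subst h2; simp [moveOne, hb, h1]; omega
    · simp [moveOne, h1, h2]

theorem exists_better {m n : ℕ} (V : Fin n → Fin m → Bool) (a b : Fin m)
    (ha : 2 * score V a < n) (hb : n < 2 * score V b)
    (hab : 2 * score V a + 2 ≤ n ∨ n + 2 ≤ 2 * score V b) :
    ∃ V' : Fin n → Fin m → Bool,
      ∑ i : Fin n, voteLen (V' i) = ∑ i : Fin n, voteLen (V i) ∧ chd V < chd V' := by
  obtain ⟨i, hia, hib⟩ : ∃ i, V i a = false ∧ V i b = true := by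
    by_contra! hcon
    have : score V b ≤ score V a := by
      refine Finset.card_le_card fun i hi => ?_
      have := hcon i
      simp at hi ⊢
      cases h : V i a
      · exact absurd hi (this h)
      · rfl
    omega
  have hne : a ≠ b := by rintro rfl; omega
  have hs := score_moveOne V i a b hia hib
  refine ⟨moveOne V i a b, ?_, ?_⟩
  · rw [sum_voteLen_eq, sum_voteLen_eq]
    have := Finset.sum_congr (rfl : (Finset.univ : Finset (Fin m)) = Finset.univ)
      fun c _ => hs c
    rw [Finset.sum_add_distrib, Finset.sum_add_distrib] at this
    simpa using this
  · rw [chd_eq_sum, chd_eq_sum]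
    have hsa := hs a
    have hsb := hs b
    simp [hne] at hsa
    simp [hne.symm] at hsb
    have hbn := score_le V b
    refine Finset.sum_lt_sum (fun c _ => ?_) ?_
    · by_cases h1 : c = a
      · subst h1; omega
      · by_cases h2 : c = b
        · subst h2; omega
        · have hsc := hs c
          simp [h1, h2] at hsc
          rw [hsc]
    · rcases hab with h | h
      · exact ⟨a, Finset.mem_univ _, by omega⟩
      · exact ⟨b, Finset.mem_univ _, by omega⟩

/-- among elections with `m` candidates, `n` voters, and saturation `α`,
`chd(E)` is largest iff the all-approving vote is central, or the all-disapproving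
vote is central, or every candidate's approval score is `⌊n/2⌋` or `⌈n/2⌉`. -/
theorem chd_largest_iff {m n : ℕ} (hm : 0 < m) (hn : 0 < n) (α : ℝ)
    (hα0 : 0 ≤ α) (hα1 : α ≤ 1)
    (V : Fin n → Fin m → Bool)
    (hsat : ((∑ i : Fin n, voteLen (V i) : ℕ) : ℝ) = α * n * m) :
    (∀ V' : Fin n → Fin m → Bool,
        ((∑ i : Fin n, voteLen (V' i) : ℕ) : ℝ) = α * n * m → chd V' ≤ chd V) ↔
      (IsCentral V (fun _ => true) ∨ IsCentral V (fun _ => false) ∨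
        ∀ c : Fin m, score V c = n / 2 ∨ score V c = (n + 1) / 2) := by
  constructor
  · intro hmax
    by_contra! hcon
    obtain ⟨h1, h2, c3, h3, h3'⟩ := hcon
    simp [IsCentral] at h1 h2
    obtain ⟨c1, hc1⟩ := h1
    obtain ⟨c2, hc2⟩ := h2
    have key : ∃ a b, 2 * score V a < n ∧ n < 2 * score V b ∧
        (2 * score V a + 2 ≤ n ∨ n + 2 ≤ 2 * score V b) := by
      by_cases h : 2 * score V c3 < n
      · exact ⟨c3, c2, h, hc2, by omega⟩
      · exact ⟨c1, c3, hc1, by omega, by omega⟩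
    obtain ⟨a, b, ha, hb, hab⟩ := key
    obtain ⟨V', hV', hlt⟩ := exists_better V a b ha hb hab
    have := hmax V' (by rw [hV']; exact hsat)
    omega
  · intro h V' hV'
    have hsum : ∑ c : Fin m, score V' c = ∑ c : Fin m, score V c := by
      rw [← sum_voteLen_eq, ← sum_voteLen_eq]
      exact_mod_cast hV'.trans hsat.symm
    rw [chd_eq_sum, chd_eq_sum]
    rcases h with h | h | h
    · have e : ∀ W : Fin n → Fin m → Bool,
          ∑ c : Fin m, (n - score W c) + ∑ c : Fin m, score W c = m * n := by
        intro W
        rw [← Finset.sum_add_distrib,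
          Finset.sum_congr rfl fun c _ => Nat.sub_add_cancel (score_le W c)]
        simp
      have e1 := e V
      have e2 := e V'
      have l1 : ∑ c : Fin m, min (score V' c) (n - score V' c) ≤
          ∑ c : Fin m, (n - score V' c) :=
        Finset.sum_le_sum fun c _ => min_le_right _ _
      have l2 : ∑ c : Fin m, (n - score V c) ≤
          ∑ c : Fin m, min (score V c) (n - score V c) :=
        Finset.sum_le_sum fun c _ => by
          have := (h c).1 rfl
          omega
      omega
    · have l1 : ∑ c : Fin m, min (score V' c) (n - score V' c) ≤
          ∑ c : Fin m, score V' c :=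
        Finset.sum_le_sum fun c _ => min_le_left _ _
      have l2 : ∑ c : Fin m, score V c ≤
          ∑ c : Fin m, min (score V c) (n - score V c) :=
        Finset.sum_le_sum fun c _ => by
          have := (h c).2 rfl
          omega
      omega
    · refine Finset.sum_le_sum fun c _ => ?_
      have := h c
      omega
end
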